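/- Let G be a connected d-regular simple graph on n vertices with adjacency eigenvalues λ₁ ≥ λ₂ ≥ … ≥ λₙ. For a vertex i and distinct vertices j, k both different from i, define α_{ijk} = −1 − 2√((d−N(i,j)−1)(d−N(i,k)−1)) if j ∼ i and k ∼ i; α_{ijk} = −2√((d−N(i,j))(d−N(i,k))) if j ≁ i and k ≁ i; and α_{ijk} = −1/2 − √(1/4 + 4(d−N(i,j)−1)(d−N(i,k))) if j ∼ i and k ≁ i. Define β_{ijk} = −1 + 2√((d−N(i,j)−1)(d−N(i,k)−1)) if j ∼ i and k ∼ i; β_{ijk} = 2√((d−N(i,j))(d−N(i,k))) if j ≁ i and k ≁ i; and β_{ijk} = −1/2 + √(1/4 + 4(d−N(i,j)−1)(d−N(i,k))) if j ∼ i and k ≁ i. Then max_i min_{j,k ≠ i, j ≠ k} α_{ijk} ≤ λₙ ≤ λ₂ ≤ min_i max_{j,k ≠ i, j ≠ k} β_{ijk}. -/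

import Mathlib

set_option autoImplicit false

open Matrix Polynomial

/-- The number of common neighbours `N(i,j)` of two vertices, as a real number. -/
noncomputable def commonNbrs {n : ℕ} (G : SimpleGraph (Fin n)) [DecidableRel G.Adj]
    (i j : Fin n) : ℝ :=
  ((G.neighborFinset i ∩ G.neighborFinset j).card : ℝ)

/-- `α_{ijk}`: equals `-1 - 2√((d-N(i,j)-1)(d-N(i,k)-1))` if `j ∼ i, k ∼ i`;
`-2√((d-N(i,j))(d-N(i,k)))` if `j ≁ i, k ≁ i`; and
`-1/2 - √(1/4 + 4(d-N(i,j)-1)(d-N(i,k)))` if `j ∼ i, k ≁ i` (symmetrically if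
`j ≁ i, k ∼ i`). -/
noncomputable def alpha10 {n : ℕ} (G : SimpleGraph (Fin n)) [DecidableRel G.Adj]
    (d : ℕ) (i j k : Fin n) : ℝ :=
  if G.Adj j i then
    (if G.Adj k i then
      -1 - 2 * Real.sqrt (((d : ℝ) - commonNbrs G i j - 1) * ((d : ℝ) - commonNbrs G i k - 1))
    else
      -(1 / 2) - Real.sqrt (1 / 4 + 4 * ((d : ℝ) - commonNbrs G i j - 1) *
        ((d : ℝ) - commonNbrs G i k)))
  else
    (if G.Adj k i then
      -(1 / 2) - Real.sqrt (1 / 4 + 4 * ((d : ℝ) - commonNbrs G i k - 1) *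
        ((d : ℝ) - commonNbrs G i j))
    else
      -2 * Real.sqrt (((d : ℝ) - commonNbrs G i j) * ((d : ℝ) - commonNbrs G i k)))

/-- `β_{ijk}`: equals `-1 + 2√((d-N(i,j)-1)(d-N(i,k)-1))` if `j ∼ i, k ∼ i`;
`2√((d-N(i,j))(d-N(i,k)))` if `j ≁ i, k ≁ i`; and
`-1/2 + √(1/4 + 4(d-N(i,j)-1)(d-N(i,k)))` if `j ∼ i, k ≁ i` (symmetrically if
`j ≁ i, k ∼ i`). -/
noncomputable def beta10 {n : ℕ} (G : SimpleGraph (Fin n)) [DecidableRel G.Adj]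
    (d : ℕ) (i j k : Fin n) : ℝ :=
  if G.Adj j i then
    (if G.Adj k i then
      -1 + 2 * Real.sqrt (((d : ℝ) - commonNbrs G i j - 1) * ((d : ℝ) - commonNbrs G i k - 1))
    else
      -(1 / 2) + Real.sqrt (1 / 4 + 4 * ((d : ℝ) - commonNbrs G i j - 1) *
        ((d : ℝ) - commonNbrs G i k)))
  else
    (if G.Adj k i then
      -(1 / 2) + Real.sqrt (1 / 4 + 4 * ((d : ℝ) - commonNbrs G i k - 1) *
        ((d : ℝ) - commonNbrs G i j))
    else
      2 * Real.sqrt (((d : ℝ) - commonNbrs G i j) * ((d : ℝ) - commonNbrs G i k)))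

section

variable {n : ℕ} (G : SimpleGraph (Fin n)) [DecidableRel G.Adj]

/-- The off-diagonal absolute sum of row `k` of the matrix with entries `A k j - A i j`, where
row and column `i` are deleted. -/
noncomputable def deflatedRadius (i k : Fin n) : ℝ :=
  ∑ j ∈ (Finset.univ.erase i).erase k, |G.adjMatrix ℝ k j - G.adjMatrix ℝ i j|

lemma deflatedRadius_nonneg (i k : Fin n) : 0 ≤ deflatedRadius G i k :=
  Finset.sum_nonneg fun _ _ => abs_nonneg _

lemma sum_adjMatrix_row {d : ℕ} (hreg : G.IsRegularOfDegree d) (i : Fin n) :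
    ∑ j, G.adjMatrix ℝ i j = d := by
  have h : G.degree i = d := hreg i
  simp [SimpleGraph.adjMatrix_apply, Finset.sum_boole, ← SimpleGraph.neighborFinset_eq_filter, h]

lemma sum_adjMatrix_mul_row (i k : Fin n) :
    ∑ j, G.adjMatrix ℝ k j * G.adjMatrix ℝ i j = commonNbrs G i k := by
  simp only [SimpleGraph.adjMatrix_apply, commonNbrs, SimpleGraph.neighborFinset_eq_filter,
    ← Finset.filter_and, ite_mul, one_mul, zero_mul, ← ite_and, Finset.sum_boole]
  simp only [and_comm]

lemma deflatedRadius_eq {d : ℕ} (hreg : G.IsRegularOfDegree d) {i k : Fin n} (hk : k ≠ i) :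
    deflatedRadius G i k = 2 * (d - commonNbrs G i k - G.adjMatrix ℝ k i) := by
  have habs : ∀ j, |G.adjMatrix ℝ k j - G.adjMatrix ℝ i j| =
      G.adjMatrix ℝ k j + G.adjMatrix ℝ i j - 2 * (G.adjMatrix ℝ k j * G.adjMatrix ℝ i j) := by
    intro j
    simp only [SimpleGraph.adjMatrix_apply]
    split_ifs <;> norm_num
  have hall : ∑ j, |G.adjMatrix ℝ k j - G.adjMatrix ℝ i j| = 2 * (d - commonNbrs G i k) := by
    simp only [habs, Finset.sum_sub_distrib, Finset.sum_add_distrib, ← Finset.mul_sum,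
      sum_adjMatrix_row G hreg, sum_adjMatrix_mul_row]
    ring
  rw [← Finset.add_sum_erase _ _ (Finset.mem_univ i),
    ← Finset.add_sum_erase _ _ (Finset.mem_erase.2 ⟨hk, Finset.mem_univ k⟩)] at hall
  have hsymm : G.adjMatrix ℝ i k = G.adjMatrix ℝ k i := by
    simp [SimpleGraph.adjMatrix_apply, G.adj_comm]
  have hnonneg : 0 ≤ G.adjMatrix ℝ k i := by
    simp only [SimpleGraph.adjMatrix_apply]
    split_ifs <;> norm_num
  rw [hsymm] at hall
  simp only [SimpleGraph.adjMatrix_apply, SimpleGraph.irrefl, if_false, sub_zero, zero_sub,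
    abs_neg] at hall hnonneg ⊢
  rw [abs_of_nonneg hnonneg] at hall
  simp only [deflatedRadius, SimpleGraph.adjMatrix_apply]
  linarith

/-- Brauer's Cassini-oval bound for the deflated adjacency matrix. -/
lemma exists_cassini_of_mulVec_eq {d : ℕ} (hn : 3 ≤ n) (hreg : G.IsRegularOfDegree d)
    {x : Fin n → ℝ} {l : ℝ} (hx : G.adjMatrix ℝ *ᵥ x = l • x) (i : Fin n)
    (hne : ∃ j, x j ≠ x i) :
    ∃ p q : Fin n, p ≠ i ∧ q ≠ i ∧ p ≠ q ∧
      |l + G.adjMatrix ℝ p i| * |l + G.adjMatrix ℝ q i| ≤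
        deflatedRadius G i p * deflatedRadius G i q := by
  set y : Fin n → ℝ := fun j => x j - x i with hy
  have hAy : ∀ k, ∑ j, (G.adjMatrix ℝ k j - G.adjMatrix ℝ i j) * y j = l * y k := by
    intro k
    have hxr : ∀ k, ∑ j, G.adjMatrix ℝ k j * x j = l * x k := fun k => congrFun hx k
    simp only [hy, sub_mul, mul_sub, Finset.sum_sub_distrib, hxr, ← Finset.sum_mul,
      sum_adjMatrix_row G hreg]
    ring
  have hrow : ∀ k, k ≠ i → (l + G.adjMatrix ℝ k i) * y k =
      ∑ j ∈ (Finset.univ.erase i).erase k,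
        (G.adjMatrix ℝ k j - G.adjMatrix ℝ i j) * y j := by
    intro k hk
    have h := hAy k
    rw [← Finset.add_sum_erase _ _ (Finset.mem_univ i),
      ← Finset.add_sum_erase _ _ (Finset.mem_erase.2 ⟨hk, Finset.mem_univ k⟩)] at h
    have hyi : y i = 0 := sub_self _
    have hsymm : G.adjMatrix ℝ i k = G.adjMatrix ℝ k i := by
      simp [SimpleGraph.adjMatrix_apply, G.adj_comm]
    have hdiag : G.adjMatrix ℝ k k = 0 := by simp
    rw [hyi, hsymm, hdiag] at h
    linarith
  have hbound : ∀ k, k ≠ i → ∀ c, (∀ j, j ≠ i → j ≠ k → |y j| ≤ c) →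
      |l + G.adjMatrix ℝ k i| * |y k| ≤ deflatedRadius G i k * c := by
    intro k hk c hc
    rw [← abs_mul, hrow k hk, deflatedRadius, Finset.sum_mul]
    refine (Finset.abs_sum_le_sum_abs _ _).trans (Finset.sum_le_sum fun j hj => ?_)
    simp only [Finset.mem_erase, Finset.mem_univ, and_true] at hj
    rw [abs_mul]
    exact mul_le_mul_of_nonneg_left (hc j hj.2 hj.1) (abs_nonneg _)
  obtain ⟨j₀, hj₀⟩ := hne
  have hj₀i : j₀ ≠ i := fun h => hj₀ (by rw [h])
  obtain ⟨p, hp, hpmax⟩ := Finset.exists_max_image (Finset.univ.erase i) (fun j => |y j|)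
    ⟨j₀, by simpa using hj₀i⟩
  have hpi : p ≠ i := by simpa using hp
  have hcard : 0 < ((Finset.univ.erase i).erase p).card := by
    rw [Finset.card_erase_of_mem hp, Finset.card_erase_of_mem (Finset.mem_univ i)]
    simp
    omega
  obtain ⟨q, hq, hqmax⟩ := Finset.exists_max_image ((Finset.univ.erase i).erase p)
    (fun j => |y j|) (Finset.card_pos.1 hcard)
  simp only [Finset.mem_erase, Finset.mem_univ, and_true] at hq hpmax hqmax
  have hypos : 0 < |y p| :=
    lt_of_lt_of_le (abs_pos.2 (sub_ne_zero.2 hj₀)) (hpmax j₀ hj₀i)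
  have hbp := hbound p hpi |y q| fun j hj hjp => hqmax j ⟨hjp, hj⟩
  have hbq := hbound q hq.2 |y p| fun j hj _ => hpmax j hj
  have hRp := deflatedRadius_nonneg G i p
  have hRq := deflatedRadius_nonneg G i q
  refine ⟨p, q, hpi, hq.2, hq.1.symm, ?_⟩
  rcases (abs_nonneg (y q)).eq_or_lt with h0 | h0
  · rw [← h0, mul_zero] at hbp
    have hz : |l + G.adjMatrix ℝ p i| = 0 :=
      le_antisymm (nonpos_of_mul_nonpos_left hbp hypos) (abs_nonneg _)
    rw [hz, zero_mul]
    exact mul_nonneg hRp hRq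
  · refine le_of_mul_le_mul_right ?_ (mul_pos hypos h0)
    calc _ = (|l + G.adjMatrix ℝ p i| * |y p|) * (|l + G.adjMatrix ℝ q i| * |y q|) := by ring
      _ ≤ (deflatedRadius G i p * |y q|) * (deflatedRadius G i q * |y p|) :=
        mul_le_mul hbp hbq (by positivity) (by positivity)
      _ = _ := by ring

lemma abs_le_two_mul_sqrt {t a : ℝ} (h : |t| * |t| ≤ 4 * a) : |t| ≤ 2 * √a := by
  have h4 : √(4 * a) = 2 * √a := by
    rw [Real.sqrt_mul (by norm_num), show (4 : ℝ) = 2 ^ 2 by norm_num, Real.sqrt_sq (by norm_num)]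
  rw [← h4]
  exact Real.abs_le_sqrt (by rwa [abs_mul_abs_self, ← sq] at h)

lemma abs_add_half_le_sqrt {t a : ℝ} (h : |t + 1| * |t| ≤ 4 * a) :
    |t + 1 / 2| ≤ √(1 / 4 + 4 * a) := by
  refine Real.abs_le_sqrt ?_
  have := (le_abs_self ((t + 1) * t)).trans ((abs_mul _ _).trans_le h)
  linarith

lemma alpha10_le_and_le_beta10 {d : ℕ} (hreg : G.IsRegularOfDegree d) {l : ℝ} {i p q : Fin n}
    (hp : p ≠ i) (hq : q ≠ i)
    (h : |l + G.adjMatrix ℝ p i| * |l + G.adjMatrix ℝ q i| ≤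
      deflatedRadius G i p * deflatedRadius G i q) :
    alpha10 G d i p q ≤ l ∧ l ≤ beta10 G d i p q := by
  rw [deflatedRadius_eq G hreg hp, deflatedRadius_eq G hreg hq] at h
  simp only [SimpleGraph.adjMatrix_apply] at h
  unfold alpha10 beta10
  split_ifs at h ⊢ with h1 h2 h2
  · have := abs_le.1 (abs_le_two_mul_sqrt (h.trans_eq (by ring) :
      _ ≤ 4 * ((d - commonNbrs G i p - 1) * (d - commonNbrs G i q - 1))))
    constructor <;> linarith
  · rw [add_zero, sub_zero] at h
    have := abs_le.1 (abs_add_half_le_sqrt (h.trans_eq (by ring) :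
      _ ≤ 4 * ((d - commonNbrs G i p - 1) * (d - commonNbrs G i q))))
    rw [← mul_assoc] at this
    constructor <;> linarith
  · rw [add_zero, sub_zero, mul_comm |l|] at h
    have := abs_le.1 (abs_add_half_le_sqrt (h.trans_eq (by ring) :
      _ ≤ 4 * ((d - commonNbrs G i q - 1) * (d - commonNbrs G i p))))
    rw [← mul_assoc] at this
    constructor <;> linarith
  · simp only [add_zero, sub_zero] at h
    have := abs_le.1 (abs_le_two_mul_sqrt (h.trans_eq (by ring) :
      _ ≤ 4 * ((d - commonNbrs G i p) * (d - commonNbrs G i q))))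
    constructor <;> linarith

lemma alpha10_nonpos (d : ℕ) (i j k : Fin n) : alpha10 G d i j k ≤ 0 := by
  unfold alpha10
  split_ifs <;> simp only [neg_mul, sub_nonpos, neg_nonpos] <;>
    linarith [Real.sqrt_nonneg (((d : ℝ) - commonNbrs G i j - 1) * (d - commonNbrs G i k - 1)),
      Real.sqrt_nonneg (1 / 4 + 4 * ((d : ℝ) - commonNbrs G i j - 1) * (d - commonNbrs G i k)),
      Real.sqrt_nonneg (1 / 4 + 4 * ((d : ℝ) - commonNbrs G i k - 1) * (d - commonNbrs G i j)),
      Real.sqrt_nonneg (((d : ℝ) - commonNbrs G i j) * (d - commonNbrs G i k))]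

lemma iInf_alpha10_le_and_le_iSup_beta10 {d : ℕ} (hn : 3 ≤ n) (hreg : G.IsRegularOfDegree d)
    {x : Fin n → ℝ} {l : ℝ} (hx : G.adjMatrix ℝ *ᵥ x = l • x) (i : Fin n)
    (hne : ∃ j, x j ≠ x i) :
    (⨅ p : {p : Fin n × Fin n // p.1 ≠ i ∧ p.2 ≠ i ∧ p.1 ≠ p.2},
        alpha10 G d i p.1.1 p.1.2) ≤ l ∧
      l ≤ ⨆ p : {p : Fin n × Fin n // p.1 ≠ i ∧ p.2 ≠ i ∧ p.1 ≠ p.2},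
        beta10 G d i p.1.1 p.1.2 := by
  obtain ⟨p, q, hp, hq, hpq, h⟩ := exists_cassini_of_mulVec_eq G hn hreg hx i hne
  obtain ⟨ha, hb⟩ := alpha10_le_and_le_beta10 G hreg hp hq h
  exact ⟨(ciInf_le (Set.finite_range _).bddBelow ⟨(p, q), hp, hq, hpq⟩).trans ha,
    hb.trans (le_ciSup (f := fun p : {p : Fin n × Fin n // p.1 ≠ i ∧ p.2 ≠ i ∧ p.1 ≠ p.2} =>
      beta10 G d i p.1.1 p.1.2) (Set.finite_range _).bddAbove ⟨(p, q), hp, hq, hpq⟩)⟩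

lemma iInf_alpha10_nonpos (d : ℕ) (i : Fin n) :
    (⨅ p : {p : Fin n × Fin n // p.1 ≠ i ∧ p.2 ≠ i ∧ p.1 ≠ p.2},
        alpha10 G d i p.1.1 p.1.2) ≤ 0 :=
  Real.iInf_nonpos fun _ => alpha10_nonpos G d i _ _

lemma exists_perm_comp_of_map_univ_eq {f g : Fin n → ℝ}
    (h : Multiset.map f Finset.univ.val = Multiset.map g Finset.univ.val) :
    ∃ σ : Equiv.Perm (Fin n), f = g ∘ σ := by
  have hperm : (List.ofFn f).Perm (List.ofFn g) := by
    rwa [Fin.univ_val_map, Fin.univ_val_map, Multiset.coe_eq_coe] at h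
  have hsort : f ∘ Tuple.sort f = g ∘ Tuple.sort g := List.ofFn_injective <|
    (((Equiv.Perm.ofFn_comp_perm _ f).trans hperm).trans
      (Equiv.Perm.ofFn_comp_perm _ g).symm).eq_of_sortedLE
      (Tuple.monotone_sort f).sortedLE_ofFn (Tuple.monotone_sort g).sortedLE_ofFn
  refine ⟨(Tuple.sort f).symm.trans (Tuple.sort g), funext fun j => ?_⟩
  simpa using congrFun hsort ((Tuple.sort f).symm j)

lemma exists_orthogonal_eigenvectors {A : Matrix (Fin n) (Fin n) ℝ} (hA : A.IsHermitian)
    {μ : Fin n → ℝ} (hchar : A.charpoly = ∏ i, (X - C (μ i))) :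
    ∃ v : Fin n → Fin n → ℝ, (∀ m, v m ≠ 0) ∧ (∀ m, A *ᵥ v m = μ m • v m) ∧
      ∀ m m', m ≠ m' → v m ⬝ᵥ v m' = 0 := by
  have hroots : Multiset.map μ Finset.univ.val = Multiset.map hA.eigenvalues Finset.univ.val := by
    have h := hA.charpoly_eq.symm.trans hchar
    have h' := congrArg Polynomial.roots h
    rw [Polynomial.roots_prod _ _ (Finset.prod_ne_zero_iff.2 fun _ _ => X_sub_C_ne_zero _),
      Polynomial.roots_prod _ _ (Finset.prod_ne_zero_iff.2 fun _ _ => X_sub_C_ne_zero _)] at h'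
    simpa using h'.symm
  obtain ⟨σ, hσ⟩ := exists_perm_comp_of_map_univ_eq hroots
  refine ⟨fun m => hA.eigenvectorBasis (σ m), fun m h => ?_, fun m => ?_, fun m m' hm => ?_⟩
  · exact hA.eigenvectorBasis.orthonormal.ne_zero (σ m) (by ext j; exact congrFun h j)
  · rw [hσ]
    exact hA.mulVec_eigenvectorBasis (σ m)
  · have h := hA.eigenvectorBasis.orthonormal.2 (σ.injective.ne hm.symm)
    simpa [EuclideanSpace.inner_eq_star_dotProduct] using h

end

/-- For a connected `d`-regular graph on `n` vertices with adjacency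
eigenvalues `λ₁ ≥ … ≥ λₙ` (encoded by an antitone `μ` via the characteristic polynomial),
`max_i min_{j,k ≠ i, j ≠ k} α_{ijk} ≤ λₙ ≤ λ₂ ≤ min_i max_{j,k ≠ i, j ≠ k} β_{ijk}`. -/
theorem stmt_10 {n d : ℕ} (hn : 3 ≤ n) (G : SimpleGraph (Fin n)) [DecidableRel G.Adj]
    (hconn : G.Connected) (hreg : G.IsRegularOfDegree d)
    (μ : Fin n → ℝ) (hanti : Antitone μ)
    (hchar : (G.adjMatrix ℝ).charpoly = ∏ i, (Polynomial.X - Polynomial.C (μ i))) :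
    (⨆ i : Fin n, ⨅ p : {p : Fin n × Fin n // p.1 ≠ i ∧ p.2 ≠ i ∧ p.1 ≠ p.2},
        alpha10 G d i p.1.1 p.1.2) ≤ μ ⟨n - 1, by omega⟩ ∧
    μ ⟨n - 1, by omega⟩ ≤ μ ⟨1, by omega⟩ ∧
    μ ⟨1, by omega⟩ ≤
      ⨅ i : Fin n, ⨆ p : {p : Fin n × Fin n // p.1 ≠ i ∧ p.2 ≠ i ∧ p.1 ≠ p.2},
        beta10 G d i p.1.1 p.1.2 := by
  have : Nonempty (Fin n) := ⟨⟨0, by omega⟩⟩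
  obtain ⟨v, hv0, hv, hvo⟩ := exists_orthogonal_eigenvectors
    (by simp [Matrix.IsHermitian]) hchar
  have hconst : ∀ m i, (¬ ∃ j, v m j ≠ v m i) → v m i ≠ 0 ∧ μ m = d := by
    intro m i h
    push Not at h
    have hi : v m i ≠ 0 := fun h0 => hv0 m (funext fun j => (h j).trans h0)
    have hr : ∑ j, G.adjMatrix ℝ i j * v m j = μ m * v m i := congrFun (hv m) i
    simp only [h, ← Finset.sum_mul, sum_adjMatrix_row G hreg] at hr
    exact ⟨hi, (mul_right_cancel₀ hi hr).symm⟩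
  refine ⟨ciSup_le fun i => ?_, hanti (by simp [Fin.le_def]; omega), le_ciInf fun i => ?_⟩
  · by_cases h : ∃ j, v ⟨n - 1, by omega⟩ j ≠ v ⟨n - 1, by omega⟩ i
    · exact (iInf_alpha10_le_and_le_iSup_beta10 G hn hreg (hv _) i h).1
    · rw [(hconst _ i h).2]
      exact (iInf_alpha10_nonpos G d i).trans (Nat.cast_nonneg d)
  · by_cases h : ∃ j, v ⟨1, by omega⟩ j ≠ v ⟨1, by omega⟩ i
    · exact (iInf_alpha10_le_and_le_iSup_beta10 G hn hreg (hv _) i h).2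
    · by_cases h' : ∃ j, v ⟨0, by omega⟩ j ≠ v ⟨0, by omega⟩ i
      · exact (hanti (by simp [Fin.le_def])).trans
          (iInf_alpha10_le_and_le_iSup_beta10 G hn hreg (hv _) i h').2
      · have ho := hvo ⟨0, by omega⟩ ⟨1, by omega⟩ (by simp)
        have h0 := (hconst _ i h').1
        have h1 := (hconst _ i h).1
        push Not at h h'
        simp only [dotProduct, h, h', Finset.sum_const, Finset.card_univ, Fintype.card_fin,
          nsmul_eq_mul] at ho
        have hn0 : (n : ℝ) ≠ 0 := by exact_mod_cast (by omega : n ≠ 0)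
        exact absurd ho (mul_ne_zero hn0 (mul_ne_zero h0 h1))
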